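/- arXiv:1501.06381 — 2 statements merged into one kernel-verified Lean document; each statement's English description precedes it below -/
import Mathlib

section
/- Let K be a compact Hausdorff space with |K| > 2^ℵ₀ (cardinality strictly greater than the continuum). Then K admits an uncountable linked family of closed pairs, and hence the closed unit ball of C(K) contains an uncountable 2-equilateral set. -/
/-- A family of pairs `(A i, B i)` of subsets of a set is *linked* if the members of each
pair are disjoint, each pair has nonempty union, and for distinct indices `i ≠ j` either
`A i` meets `B j` or `A j` meets `B i`. -/
def IsLinked {Γ ι : Type*} (A B : ι → Set Γ) : Prop :=
  (∀ i, A i ∩ B i = ∅) ∧ (∀ i, (A i ∪ B i).Nonempty) ∧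
    ∀ i j, i ≠ j → (A i ∩ B j).Nonempty ∨ (A j ∩ B i).Nonempty

open Set

/-- A closed linked family separated by continuous functions gives a `2`-equilateral family. -/
theorem IsLinked.exists_equilateral {K ι : Type*} [TopologicalSpace K] [CompactSpace K] [T2Space K]
    {A B : ι → Set K} (hA : ∀ i, IsClosed (A i)) (hB : ∀ i, IsClosed (B i)) (h : IsLinked A B) :
    ∃ f : ι → C(K, ℝ), (∀ i, f i ∈ Metric.closedBall 0 1) ∧
      ∀ i j, i ≠ j → dist (f i) (f j) = 2 := by
  have key : ∀ i, ∃ f : C(K, ℝ), (∀ x ∈ A i, f x = 1) ∧ (∀ x ∈ B i, f x = -1) ∧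
      ∀ x, |f x| ≤ 1 := by
    intro i
    obtain ⟨g, hg0, hg1, hg⟩ := exists_continuous_zero_one_of_isClosed (hA i) (hB i)
      (disjoint_iff_inter_eq_empty.2 (h.1 i))
    refine ⟨1 - (2 : ℝ) • g, fun x hx => ?_, fun x hx => ?_, fun x => ?_⟩
    · simp [hg0 hx]
    · simp only [ContinuousMap.sub_apply, ContinuousMap.smul_apply, ContinuousMap.one_apply,
        hg1 hx, Pi.one_apply, smul_eq_mul]
      norm_num
    · have := hg x
      simp only [ContinuousMap.sub_apply, ContinuousMap.smul_apply, ContinuousMap.one_apply,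
        smul_eq_mul]
      rw [abs_le]
      constructor <;> linarith [this.1, this.2]
  choose f hfA hfB hf using key
  have apart : ∀ i j, (A i ∩ B j).Nonempty → 2 ≤ dist (f i) (f j) := by
    rintro i j ⟨x, hxA, hxB⟩
    refine le_trans ?_ (ContinuousMap.dist_apply_le_dist x)
    rw [hfA i x hxA, hfB j x hxB, Real.dist_eq]
    norm_num
  refine ⟨f, fun i => ?_, fun i j hij => le_antisymm ?_ ?_⟩
  · rw [mem_closedBall_zero_iff, ContinuousMap.norm_le _ zero_le_one]
    exact hf i
  · rw [ContinuousMap.dist_le zero_le_two]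
    intro x
    rw [Real.dist_eq, abs_le]
    have h1 := abs_le.1 (hf i x)
    have h2 := abs_le.1 (hf j x)
    constructor <;> linarith [h1.1, h1.2, h2.1, h2.2]
  · rcases h.2.2 i j hij with hm | hm
    · exact apart i j hm
    · exact dist_comm (f i) (f j) ▸ apart j i hm

/-- A strictly decreasing family of closed sets yields a linked family of closed pairs. -/
theorem exists_isLinked_of_strictAnti {K ι : Type*} [TopologicalSpace K] [T1Space K]
    [LinearOrder ι] (F G : ι → Set K) (hG : ∀ i, IsClosed (G i))
    (hFG : ∀ i, (F i \ G i).Nonempty) (h : ∀ i j, i < j → F j ⊆ G i) :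
    ∃ A B : ι → Set K, (∀ i, IsClosed (A i)) ∧ (∀ i, IsClosed (B i)) ∧ IsLinked A B := by
  choose y hyF hyG using hFG
  refine ⟨fun i => {y i}, G, fun i => isClosed_singleton, hG, fun i => ?_, fun i => ?_, ?_⟩
  · simpa using hyG i
  · exact ⟨y i, Or.inl rfl⟩
  · intro i j hij
    rcases hij.lt_or_gt with hlt | hlt
    · exact Or.inr ⟨y j, rfl, h i j hlt (hyF j)⟩
    · exact Or.inl ⟨y i, rfl, h j i hlt (hyF i)⟩

/-- A nontrivial set in a Hausdorff space is covered by two closed sets, neither containing it. -/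
theorem Set.Nontrivial.exists_isClosed_cover {K : Type*} [TopologicalSpace K] [T2Space K]
    {F : Set K} (hF : F.Nontrivial) :
    ∃ L R : Set K, IsClosed L ∧ IsClosed R ∧ L ∪ R = univ ∧ ¬ F ⊆ L ∧ ¬ F ⊆ R := by
  obtain ⟨x, hx, y, hy, hxy⟩ := hF
  obtain ⟨U, V, hU, hV, hxU, hyV, hUV⟩ := t2_separation hxy
  exact ⟨Uᶜ, Vᶜ, hU.isClosed_compl, hV.isClosed_compl,
    by rw [← compl_inter, hUV.inter_eq, compl_empty], fun h => h hx hxU, fun h => h hy hyV⟩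

open Classical in
/-- The transfinite sequence of cells containing `x`, each obtained by cutting down the earlier
cells `F` with `L F` or `R F`. -/
noncomputable def splitCell {K I : Type*} [LinearOrder I] [WellFoundedLT I]
    (L R : Set K → Set K) (x : K) (i : I) : Set K :=
  ⋂ j : Iio i, if x ∈ L (splitCell L R x j.1) then L (splitCell L R x j.1)
    else R (splitCell L R x j.1)
termination_by wellFounded_lt.wrap i
decreasing_by all_goals exact j.2

open Classical in
/-- The half of the cell of `x` at stage `i` that contains `x`. -/
noncomputable def splitHalf {K I : Type*} [LinearOrder I] [WellFoundedLT I]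
    (L R : Set K → Set K) (x : K) (i : I) : Set K :=
  if x ∈ L (splitCell L R x i) then L (splitCell L R x i) else R (splitCell L R x i)

theorem splitCell_eq {K I : Type*} [LinearOrder I] [WellFoundedLT I]
    (L R : Set K → Set K) (x : K) (i : I) :
    splitCell L R x i = ⋂ j : Iio i, splitHalf L R x j.1 := by
  rw [splitCell]; rfl

theorem mem_splitCell {K I : Type*} [LinearOrder I] [WellFoundedLT I]
    {L R : Set K → Set K} (hLR : ∀ F, L F ∪ R F = Set.univ) (x : K) (i : I) :
    x ∈ splitCell L R x i := by
  rw [splitCell_eq, mem_iInter]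
  intro j
  unfold splitHalf
  split_ifs with hx
  · exact hx
  · have := mem_univ x
    rw [← hLR (splitCell L R x j.1)] at this
    exact this.resolve_left hx

/-- Cells up to stage `i` are determined by the left/right choices made before stage `i`. -/
theorem splitCell_congr {K I : Type*} [LinearOrder I] [WellFoundedLT I]
    {L R : Set K → Set K} {x y : K} (i : I)
    (h : ∀ j < i, x ∈ L (splitCell L R x j) ↔ y ∈ L (splitCell L R y j)) :
    splitCell L R x i = splitCell L R y i := by
  induction i using WellFoundedLT.induction with
  | ind i ih =>
    rw [splitCell_eq, splitCell_eq]
    refine iInter_congr fun j => ?_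
    have hj := h j.1 j.2
    have := ih j.1 j.2 fun k hk => h k (hk.trans j.2)
    unfold splitHalf
    rw [this] at hj ⊢
    by_cases hx : y ∈ L (splitCell L R y j.1)
    · rw [if_pos (hj.2 hx), if_pos hx]
    · rw [if_neg (mt hj.1 hx), if_neg hx]

open Cardinal in
/-- If `K` has more than `𝔠` points and is split along a well-order with countable initial segments
and at most `𝔠` elements, then some point has only nontrivial cells. -/
theorem exists_forall_splitCell_nontrivial {K I : Type u} [LinearOrder I] [WellFoundedLT I]
    (hI : #I ≤ 2 ^ ℵ₀) (hc : ∀ i : I, (Iio i).Countable) (h : 2 ^ ℵ₀ < #K)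
    {L R : Set K → Set K} (hLR : ∀ F, L F ∪ R F = Set.univ) :
    ∃ x : K, ∀ i : I, (splitCell L R x i).Nontrivial := by
  by_contra! hx
  choose t ht using hx
  let code : K → Σ i : I, Set (Iio i) := fun x =>
    ⟨t x, {j | x ∈ L (splitCell L R x j.1)}⟩
  have inj : Function.Injective code := by
    intro x y hxy
    have h1 : t x = t y := congrArg Sigma.fst hxy
    have h2 : ∀ j < t x, x ∈ L (splitCell L R x j) ↔ y ∈ L (splitCell L R y j) := by
      intro j hj
      have := congrArg (fun s : Σ i : I, Set (Iio i) => ∃ k ∈ s.2, k.1 = j) hxy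
      simpa [code, hj, h1 ▸ hj] using this
    have h3 := splitCell_congr (t x) h2
    refine ht x (mem_splitCell hLR x _) ?_
    rw [h3]
    exact mem_splitCell hLR y _
  refine (mk_le_of_injective inj).not_gt (lt_of_le_of_lt ?_ h)
  rw [mk_sigma]
  calc Cardinal.sum (fun i : I => #(Set (Iio i)))
    _ ≤ Cardinal.sum (fun _ : I => (2 ^ ℵ₀ : Cardinal)) := by
        refine Cardinal.sum_le_sum _ _ fun i => ?_
        rw [mk_set]
        exact power_le_power_left two_ne_zero (le_aleph0_iff_set_countable.2 (hc i))
    _ = #I * 2 ^ ℵ₀ := by simp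
    _ ≤ 2 ^ ℵ₀ * 2 ^ ℵ₀ := by gcongr
    _ = 2 ^ ℵ₀ := by rw [← power_add, aleph0_add_aleph0]

open Cardinal in
/-- There is an uncountable well-order of cardinality at most the continuum with countable
initial segments. -/
theorem exists_uncountable_wellOrder_countable_Iio :
    ∃ (I : Type u) (_ : LinearOrder I) (_ : WellFoundedLT I), #I ≤ 2 ^ ℵ₀ ∧ ¬ Countable I ∧
      ∀ i : I, (Iio i).Countable := by
  refine ⟨(Cardinal.ord ℵ₁).ToType, inferInstance, inferInstance, ?_, ?_, fun i => ?_⟩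
  · rw [mk_ord_toType]
    exact aleph_one_le_continuum
  · rw [← mk_le_aleph0_iff, mk_ord_toType, not_le]
    exact aleph0_lt_aleph_one
  · rw [← le_aleph0_iff_set_countable, ← lt_aleph_one_iff]
    simpa using mk_Iio_lt i (by simp)

/-- Theorem 2(4): if a compact Hausdorff space `K` has cardinality strictly greater than
the continuum `2^ℵ₀`, then `K` admits an uncountable linked family of closed
pairs, and the closed unit ball of `C(K)` contains an uncountable `2`-equilateral set. -/
theorem stmt6 {K : Type u} [TopologicalSpace K] [CompactSpace K] [T2Space K]
    (h : 2 ^ Cardinal.aleph0 < Cardinal.mk K) :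
    (∃ (ι : Type u) (A B : ι → Set K), (∀ i, IsClosed (A i)) ∧ (∀ i, IsClosed (B i)) ∧
      IsLinked A B ∧ ¬ Countable ι) ∧
    ∃ S : Set C(K, ℝ), S ⊆ Metric.closedBall 0 1 ∧ ¬ S.Countable ∧
      ∀ f ∈ S, ∀ g ∈ S, f ≠ g → dist f g = 2 := by
  have cover : ∀ F : Set K, ∃ L R : Set K, IsClosed L ∧ IsClosed R ∧ L ∪ R = univ ∧
      (F.Nontrivial → ¬ F ⊆ L ∧ ¬ F ⊆ R) := fun F => by
    by_cases hF : F.Nontrivial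
    · obtain ⟨L, R, hL, hR, hLR, hm⟩ := hF.exists_isClosed_cover
      exact ⟨L, R, hL, hR, hLR, fun _ => hm⟩
    · exact ⟨univ, univ, isClosed_univ, isClosed_univ, union_self _, fun hm => absurd hm hF⟩
  choose L R hL hR hLR hF using cover
  obtain ⟨I, _, _, hI, hunc, hc⟩ := exists_uncountable_wellOrder_countable_Iio.{u}
  obtain ⟨x, hx⟩ := exists_forall_splitCell_nontrivial hI hc h hLR
  obtain ⟨A, B, hA, hB, hAB⟩ := exists_isLinked_of_strictAnti (splitCell L R x)
    (splitHalf L R x : I → Set K)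
    (fun i => by unfold splitHalf; split_ifs <;> simp only [hL, hR])
    (fun i => by
      rw [sdiff_nonempty]
      unfold splitHalf
      split_ifs
      exacts [(hF _ (hx i)).1, (hF _ (hx i)).2])
    (fun i j hij => by
      rw [splitCell_eq]
      exact iInter_subset_of_subset ⟨i, hij⟩ subset_rfl)
  refine ⟨⟨I, A, B, hA, hB, hAB, hunc⟩, ?_⟩
  obtain ⟨f, hball, hdist⟩ := hAB.exists_equilateral hA hB
  refine ⟨range f, range_subset_iff.2 hball, fun hcount => hunc ?_, ?_⟩
  · have inj : Function.Injective f := fun i j hij => by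
      by_contra hne
      simpa [hij] using hdist i j hne
    have := hcount.to_subtype
    exact (rangeFactorization_injective.2 inj).countable
  · rintro _ ⟨i, rfl⟩ _ ⟨j, rfl⟩ hne
    exact hdist i j fun hij => hne (congrArg f hij)
end

section
/- Let K be an infinite compact Hausdorff scattered space (every nonempty subset of K has an isolated point in its subspace topology). Then m(C(K)) = ℵ₀; that is, C(K) contains a countably infinite maximal equilateral set, and no maximal equilateral set in C(K) is finite. -/
/-- A subset `S` of a metric space is `l`-equilateral if any two distinct points of `S` are
at distance `l`. -/
def IsEquilateralWith {M : Type*} [MetricSpace M] (S : Set M) (l : ℝ) : Prop :=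
  ∀ x ∈ S, ∀ y ∈ S, x ≠ y → dist x y = l

/-- A subset of a metric space is equilateral if it is `l`-equilateral for some `l > 0`. -/
def IsEquilateral {M : Type*} [MetricSpace M] (S : Set M) : Prop :=
  ∃ l : ℝ, 0 < l ∧ IsEquilateralWith S l

/-- An equilateral set is maximal if it is not a proper subset of an equilateral set. -/
def IsMaximalEquilateral {M : Type*} [MetricSpace M] (S : Set M) : Prop :=
  IsEquilateral S ∧ ∀ T : Set M, IsEquilateral T → S ⊆ T → T = S

/-- `mNum M` is the minimum cardinality of a maximal equilateral set in `M`. -/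
noncomputable def mNum (M : Type*) [MetricSpace M] : Cardinal :=
  sInf {c : Cardinal | ∃ S : Set M, IsMaximalEquilateral S ∧ Cardinal.mk S = c}

/-- A topological space is *scattered* if every nonempty subset has a point which is
isolated in the subspace topology. -/
def IsScattered (K : Type*) [TopologicalSpace K] : Prop :=
  ∀ S : Set K, S.Nonempty → ∃ x ∈ S, ∃ U : Set K, IsOpen U ∧ U ∩ S = {x}

open Filter Topology

theorem ContinuousMap.exists_abs_sub_eq_dist {K : Type*} [TopologicalSpace K] [CompactSpace K]
    [Nonempty K] (f g : C(K, ℝ)) : ∃ x, |f x - g x| = dist f g := by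
  by_contra! h
  have h' : ∀ x, dist (f x) (g x) < dist f g := fun x =>
    lt_of_le_of_ne (ContinuousMap.dist_apply_le_dist x) (by simpa [Real.dist_eq] using h x)
  exact lt_irrefl _ ((ContinuousMap.dist_lt_iff_of_nonempty).2 h')

/-- A nonempty finite `l`-equilateral set in `C(K)` with `K` infinite has a further point at
distance `l` from all its elements. -/
theorem exists_dist_eq_of_finite_equilateral {K : Type*} [TopologicalSpace K] [CompactSpace K]
    [T2Space K] [Infinite K] (s : Finset C(K, ℝ)) (hs : s.Nonempty) {l : ℝ} (hl : 0 < l)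
    (h : IsEquilateralWith (s : Set C(K, ℝ)) l) : ∃ g : C(K, ℝ), ∀ f ∈ s, dist g f = l := by
  classical
  choose w hw using ContinuousMap.exists_abs_sub_eq_dist (K := K)
  obtain ⟨M, hM, hM'⟩ : ∃ M : C(K, ℝ), (∀ f ∈ s, ∀ x, f x ≤ M x) ∧
      ∀ x, ∃ f ∈ s, M x = f x := by
    refine ⟨s.sup' hs id, fun f hf x => Finset.le_sup' id hf x, fun x => ?_⟩
    rw [ContinuousMap.sup'_apply]
    exact Finset.exists_mem_eq_sup' hs fun f : C(K, ℝ) => f x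
  obtain ⟨m, hm, hm'⟩ : ∃ m : C(K, ℝ), (∀ f ∈ s, ∀ x, m x ≤ f x) ∧
      ∀ x, ∃ f ∈ s, m x = f x := by
    refine ⟨s.inf' hs id, fun f hf x => Finset.inf'_le id hf x, fun x => ?_⟩
    rw [ContinuousMap.inf'_apply]
    exact Finset.exists_mem_eq_inf' hs fun f : C(K, ℝ) => f x
  have hMm : ∀ x, M x ≤ m x + l := by
    intro x
    obtain ⟨f, hf, hfx⟩ := hM' x
    obtain ⟨k, hk, hkx⟩ := hm' x
    rw [hfx, hkx]
    by_cases hfk : f = k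
    · rw [hfk]; linarith
    · have h1 := ContinuousMap.dist_apply_le_dist (f := f) (g := k) x
      rw [h f hf k hk hfk, Real.dist_eq] at h1
      linarith [le_abs_self (f x - k x)]
  let F : Finset K := (s ×ˢ s).image fun p => w p.1 p.2
  obtain ⟨y, hy⟩ := Infinite.exists_notMem_finset F
  obtain ⟨f₀, hf₀, hf₀y⟩ := hm' y
  let Q : Finset K := F.filter fun x => f₀ x = m x
  let P : Finset K := insert y (F.filter fun x => f₀ x ≠ m x)
  have hdisj : Disjoint (Q : Set K) (P : Set K) := by
    rw [Finset.disjoint_coe, Finset.disjoint_left]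
    intro x hx hx'
    simp only [Q, P, Finset.mem_filter, Finset.mem_insert] at hx hx'
    rcases hx' with rfl | hx'
    · exact hy hx.1
    · exact hx'.2 hx.2
  obtain ⟨u, hu0, hu1, hu⟩ := exists_continuous_zero_one_of_isClosed
    Q.finite_toSet.isClosed P.finite_toSet.isClosed hdisj
  let g : C(K, ℝ) := ⟨fun x => (1 - u x) * (M x - l) + u x * (m x + l), by fun_prop⟩
  have hgQ : ∀ x ∈ Q, g x = M x - l := fun x hx => by
    have : u x = 0 := hu0 hx
    simp [g, this]
  have hgP : ∀ x ∈ P, g x = m x + l := fun x hx => by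
    have : u x = 1 := hu1 hx
    simp [g, this]
  have hg : ∀ x, M x - l ≤ g x ∧ g x ≤ m x + l := by
    intro x
    have h0 := (hu x).1
    have h1 := (hu x).2
    have h2 := hMm x
    simp only [g, ContinuousMap.coe_mk]
    constructor <;> nlinarith
  refine ⟨g, fun f hf => le_antisymm ?_ ?_⟩
  · refine (ContinuousMap.dist_le hl.le).2 fun x => ?_
    rw [Real.dist_eq, abs_le]
    constructor <;> linarith [hg x, hM f hf x, hm f hf x, (hg x).1, (hg x).2]
  · suffices hx : ∃ x, l ≤ |g x - f x| by
      obtain ⟨x, hx⟩ := hx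
      exact hx.trans (ContinuousMap.dist_apply_le_dist (f := g) (g := f) x)
    by_cases hff : f₀ = f
    · subst hff
      refine ⟨y, ?_⟩
      rw [hgP y (by simp [P]), hf₀y, add_sub_cancel_left]
      exact le_abs_self l
    · have hxF : w f₀ f ∈ F :=
        Finset.mem_image.2 ⟨(f₀, f), Finset.mk_mem_product hf₀ hf, rfl⟩
      have hx := hw f₀ f
      rw [h f₀ hf₀ f hf hff] at hx
      refine ⟨w f₀ f, ?_⟩
      generalize w f₀ f = x at hx hxF
      have h1 := hMm x
      have h2 := hM f hf x
      have h3 := hm f hf x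
      have h4 := hM f₀ hf₀ x
      have h5 := hm f₀ hf₀ x
      by_cases hxm : f₀ x = m x
      · rw [hgQ x (by simp [Q, hxF, hxm])]
        rcases (abs_eq hl.le).1 hx with h6 | h6
        · linarith
        · rw [le_abs]; right; linarith
      · rw [hgP x (by simp [P, hxF, hxm])]
        have h7 := lt_of_le_of_ne h5 (Ne.symm hxm)
        rcases (abs_eq hl.le).1 hx with h6 | h6
        · rw [le_abs]; left; linarith
        · linarith

theorem IsMaximalEquilateral.infinite {K : Type*} [TopologicalSpace K] [CompactSpace K]
    [T2Space K] [Infinite K] {S : Set C(K, ℝ)} (hS : IsMaximalEquilateral S) : S.Infinite := by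
  intro hfin
  obtain ⟨⟨l, hl, hSl⟩, hmax⟩ := hS
  obtain ⟨g, hg⟩ : ∃ g : C(K, ℝ), ∀ f ∈ S, dist g f = l := by
    rcases S.eq_empty_or_nonempty with rfl | hne
    · exact ⟨0, by simp⟩
    · obtain ⟨g, hg⟩ := exists_dist_eq_of_finite_equilateral hfin.toFinset
        (by simpa using hne) hl (by simpa using hSl)
      exact ⟨g, fun f hf => hg f (by simpa using hf)⟩
  have hT : insert g S = S := by
    refine hmax _ ⟨l, hl, ?_⟩ (Set.subset_insert g S)
    rintro x (rfl | hx) y (rfl | hy) hxy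
    · exact absurd rfl hxy
    · exact hg y hy
    · rw [dist_comm]; exact hg x hx
    · exact hSl x hx y hy hxy
  have hgS : g ∈ S := hT ▸ Set.mem_insert g S
  have := hg g hgS
  rw [dist_self] at this
  exact hl.ne this

/-- An infinite compact Hausdorff scattered space contains a nontrivial convergent sequence of
isolated points. -/
theorem IsScattered.exists_seq_isolated {K : Type*} [TopologicalSpace K] [CompactSpace K]
    [T2Space K] [Infinite K] (hK : IsScattered K) :
    ∃ (x : ℕ → K) (p : K), Function.Injective x ∧ (∀ n, IsOpen {x n}) ∧
      Tendsto x atTop (𝓝 p) := by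
  obtain ⟨p, hp, U, hU, hUp⟩ := hK {x | ¬ IsOpen ({x} : Set K)} (by
    by_contra hne
    rw [Set.not_nonempty_iff_eq_empty, Set.eq_empty_iff_forall_notMem] at hne
    simp only [Set.mem_ofPred_eq, not_not] at hne
    have : DiscreteTopology K := discreteTopology_iff_isOpen_singleton.2 hne
    exact not_finite_iff_infinite.2 ‹_› (finite_of_compact_of_discrete (X := K)))
  have hpU : p ∈ U := by
    have : p ∈ U ∩ {x | ¬ IsOpen ({x} : Set K)} := hUp ▸ Set.mem_singleton p
    exact this.1
  obtain ⟨V, hV, hVc, hVU⟩ := exists_mem_nhds_isClosed_subset (hU.mem_nhds hpU)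
  have hiso : ∀ y ∈ V, y ≠ p → IsOpen ({y} : Set K) := by
    intro y hy hyp
    by_contra hny
    have : y ∈ U ∩ {x | ¬ IsOpen ({x} : Set K)} := ⟨hVU hy, hny⟩
    rw [hUp] at this
    exact hyp this
  have hfin : ∀ W ∈ 𝓝 p, (V \ W).Finite := by
    intro W hW
    obtain ⟨O, hOW, hO, hpO⟩ := mem_nhds_iff.1 hW
    have hc : IsCompact (V \ O) := (hVc.sdiff hO).isCompact
    have hd : IsDiscrete (V \ O) := by
      rw [isDiscrete_iff_forall_mem_exists_isOpen]
      intro y hy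
      refine ⟨{y}, hiso y hy.1 (by rintro rfl; exact hy.2 hpO), ?_⟩
      simpa using hy
    exact (hc.finite hd).subset (Set.sdiff_subset_sdiff_right hOW)
  have hinf : (V \ {p}).Infinite := by
    intro hf
    refine hp ?_
    have h1 : V ∩ (V \ {p})ᶜ ∈ 𝓝 p :=
      Filter.inter_mem hV (hf.isClosed.isOpen_compl.mem_nhds (by simp))
    rw [isOpen_singleton_iff_nhds_eq_pure]
    refine le_antisymm ?_ (pure_le_nhds p)
    rw [le_pure_iff]
    refine Filter.mem_of_superset h1 ?_
    rintro z ⟨hz, hz'⟩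
    by_contra hzp
    exact hz' ⟨hz, hzp⟩
  let e := hinf.natEmbedding
  refine ⟨fun n => e n, p, Subtype.val_injective.comp e.injective,
    fun n => hiso _ (e n).2.1 (e n).2.2, ?_⟩
  rw [← Nat.cofinite_eq_atTop]
  intro W hW
  rw [Filter.mem_map, Filter.mem_cofinite]
  refine Set.Finite.subset ((hfin W hW).preimage
    (Subtype.val_injective.comp e.injective).injOn) ?_
  intro n hn
  exact ⟨(e n).2.1, hn⟩

open Classical in
theorem continuous_piecewise_isolated {K : Type*} [TopologicalSpace K] [T1Space K]
    (F : Finset K) (hF : ∀ x ∈ F, IsOpen ({x} : Set K)) (v : K → ℝ) (c : ℝ) :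
    Continuous fun y => if y ∈ F then v y else c := by
  rw [continuous_iff_continuousAt]
  intro y
  by_cases hy : y ∈ F
  · rw [ContinuousAt, isOpen_singleton_iff_nhds_eq_pure y |>.1 (hF y hy)]
    exact tendsto_pure_nhds _ _
  · refine ContinuousAt.congr (f := fun _ => c) continuousAt_const ?_
    filter_upwards [F.finite_toSet.isClosed.isOpen_compl.mem_nhds hy] with z hz
    rw [if_neg (by simpa using hz)]

/-- If `K` has a nontrivial convergent sequence of isolated points, then `C(K)` has a
1-equilateral sequence with values in `[0, 1]` which cannot be extended. -/
theorem exists_unextendable_equilateral_seq {K : Type*} [TopologicalSpace K] [CompactSpace K]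
    [T2Space K] {x : ℕ → K} {p : K} (hx : Function.Injective x)
    (hiso : ∀ n, IsOpen {x n}) (hlim : Tendsto x atTop (𝓝 p)) :
    ∃ f : ℕ → C(K, ℝ), (∀ n k, n ≠ k → dist (f n) (f k) = 1) ∧
      ∀ g : C(K, ℝ), ¬ ∀ n, dist g (f n) = 1 := by
  classical
  have : Nonempty K := ⟨p⟩
  let a : ℕ → ℝ := fun n => if Even n then 0 else 1
  let c : ℕ → ℝ := fun n => if Even n then 1 / ((n : ℝ) + 2) else 1 - 1 / ((n : ℝ) + 2)
  have ha : ∀ n, a n = 0 ∨ a n = 1 := fun n => by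
    by_cases h : Even n <;> simp [a, h]
  have hc : ∀ n, 0 < c n ∧ c n < 1 := fun n => by
    have h1 : (0 : ℝ) < 1 / ((n : ℝ) + 2) := by positivity
    have h2 : 1 / ((n : ℝ) + 2) < 1 := by
      rw [div_lt_one (by positivity)]
      linarith [(Nat.cast_nonneg n : (0 : ℝ) ≤ n)]
    by_cases h : Even n <;> simp only [c, h, if_true, if_false] <;> constructor <;> linarith
  let F : ℕ → Finset K := fun n => (Finset.range (n + 1)).image x
  let v : ℕ → K → ℝ := fun n => Function.extend x (fun i => if i < n then a i else 1 - a i) 0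
  let f : ℕ → C(K, ℝ) := fun n => ⟨fun y => if y ∈ F n then v n y else c n,
    continuous_piecewise_isolated (F n) (by
      intro y hy
      obtain ⟨i, -, rfl⟩ := Finset.mem_image.1 hy
      exact hiso i) (v n) (c n)⟩
  have hmem : ∀ n i, x i ∈ F n ↔ i ≤ n := fun n i => by
    simp [F, hx.eq_iff]
  have hlt : ∀ n i, i < n → f n (x i) = a i := fun n i hi => by
    simp [f, hmem, hi.le, v, hx.extend_apply, hi]
  have heq : ∀ n, f n (x n) = 1 - a n := fun n => by
    simp [f, hmem, v, hx.extend_apply]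
  have hout : ∀ n y, y ∉ F n → f n y = c n := fun n y hy => by simp [f, hy]
  have hcases : ∀ n y, (∃ i < n, y = x i) ∨ y = x n ∨ y ∉ F n := by
    intro n y
    by_cases hy : y ∈ F n
    · obtain ⟨i, hi, rfl⟩ := Finset.mem_image.1 hy
      rcases (Nat.lt_succ_iff.1 (Finset.mem_range.1 hi)).lt_or_eq with h | rfl
      · exact Or.inl ⟨i, h, rfl⟩
      · exact Or.inr (Or.inl rfl)
    · exact Or.inr (Or.inr hy)
  have hf01 : ∀ n y, 0 ≤ f n y ∧ f n y ≤ 1 := by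
    intro n y
    rcases hcases n y with ⟨i, hi, rfl⟩ | rfl | hy
    · rw [hlt n i hi]
      rcases ha i with h | h <;> rw [h] <;> norm_num
    · rw [heq n]
      rcases ha n with h | h <;> rw [h] <;> norm_num
    · rw [hout n y hy]
      exact ⟨(hc n).1.le, (hc n).2.le⟩
  have hdist : ∀ n k, n < k → dist (f n) (f k) = 1 := by
    intro n k hnk
    apply le_antisymm
    · refine (ContinuousMap.dist_le zero_le_one).2 fun y => ?_
      rw [Real.dist_eq, abs_le]
      constructor <;> linarith [(hf01 n y).1, (hf01 n y).2, (hf01 k y).1, (hf01 k y).2]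
    · refine le_trans ?_ (ContinuousMap.dist_apply_le_dist (f := f n) (g := f k) (x n))
      rw [heq n, hlt k n hnk, Real.dist_eq]
      rcases ha n with h | h <;> rw [h] <;> norm_num
  refine ⟨f, fun n k hnk => ?_, fun g hg => ?_⟩
  · rcases hnk.lt_or_gt with h | h
    · exact hdist n k h
    · rw [dist_comm]; exact hdist k n h
  have hgf : ∀ n y, |g y - f n y| ≤ 1 := fun n y => by
    rw [← hg n]
    exact ContinuousMap.dist_apply_le_dist (f := g) (g := f n) y
  have hg01 : ∀ y, 0 ≤ g y ∧ g y ≤ 1 := by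
    intro y
    by_cases hy : ∃ i, x i = y
    · obtain ⟨i, rfl⟩ := hy
      have h1 := abs_le.1 (hgf i (x i))
      have h2 := abs_le.1 (hgf (i + 1) (x i))
      rw [heq] at h1
      rw [hlt (i + 1) i i.lt_succ_self] at h2
      rcases ha i with h | h <;> rw [h] at h1 h2 <;> constructor <;> linarith [h1.1, h1.2, h2.1, h2.2]
    · have hyF : ∀ n, f n y = c n := fun n => hout n y fun hyn => by
        obtain ⟨i, -, hi⟩ := Finset.mem_image.1 hyn
        exact hy ⟨i, hi⟩
      have hsmall : ∀ ε > (0 : ℝ), ∃ n : ℕ, ∀ k ≥ n, 1 / ((k : ℝ) + 2) < ε := by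
        intro ε hε
        obtain ⟨n, hn⟩ := exists_nat_one_div_lt hε
        refine ⟨n, fun k hk => lt_of_le_of_lt ?_ hn⟩
        have : (n : ℝ) ≤ k := by exact_mod_cast hk
        exact one_div_le_one_div_of_le (by positivity) (by linarith)
      constructor
      · refine le_of_forall_pos_le_add fun ε hε => ?_
        obtain ⟨n, hn⟩ := hsmall ε hε
        have h1 := (abs_le.1 (hgf (2 * n + 1) y)).1
        have h2 := hn (2 * n + 1) (by omega)
        have h3 : ¬ Even (2 * n + 1) := by simp
        rw [hyF] at h1
        simp only [c, h3, if_false] at h1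
        linarith
      · refine le_of_forall_pos_le_add fun ε hε => ?_
        obtain ⟨n, hn⟩ := hsmall ε hε
        have h1 := (abs_le.1 (hgf (2 * n) y)).2
        have h2 := hn (2 * n) (by omega)
        have h3 : Even (2 * n) := by simp
        rw [hyF] at h1
        simp only [c, h3, if_true] at h1
        linarith
  have hne : ∃ n, g (x n) ≠ a n := by
    by_contra! h
    have hgl : Tendsto (fun n => g (x n)) atTop (𝓝 (g p)) :=
      (g.continuous.tendsto p).comp hlim
    have h0 : Tendsto (fun _ : ℕ => (0 : ℝ)) atTop (𝓝 (g p)) := by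
      refine (hgl.comp (tendsto_id.const_mul_atTop' (by norm_num : 0 < 2))).congr fun n => ?_
      simp [h, a]
    have h1 : Tendsto (fun _ : ℕ => (1 : ℝ)) atTop (𝓝 (g p)) := by
      refine (hgl.comp (tendsto_atTop_mono (fun n : ℕ => (by omega : n ≤ 2 * n + 1))
        tendsto_id)).congr fun n => ?_
      simp [h, a]
    have e0 := tendsto_nhds_unique h0 tendsto_const_nhds
    have e1 := tendsto_nhds_unique h1 tendsto_const_nhds
    linarith
  let n := Nat.find hne
  have hn : g (x n) ≠ a n := Nat.find_spec hne
  have hn' : ∀ i < n, g (x i) = a i := fun i hi => not_not.1 (Nat.find_min hne hi)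
  obtain ⟨y, hy⟩ := ContinuousMap.exists_abs_sub_eq_dist g (f n)
  rw [hg n] at hy
  have hgy := hg01 y
  rcases hcases n y with ⟨i, hi, rfl⟩ | rfl | hyF
  · rw [hlt n i hi, hn' i hi] at hy
    norm_num at hy
  · rw [heq n] at hy
    rcases (abs_eq zero_le_one).1 hy with h2 | h2 <;> rcases ha n with h | h <;>
      rw [h] at h2 hn <;> exact hn (by linarith)
  · rw [hout n y hyF] at hy
    rcases (abs_eq zero_le_one).1 hy with h2 | h2 <;>
      linarith [hgy.1, hgy.2, (hc n).1, (hc n).2]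

theorem isMaximalEquilateral_range {M : Type*} [MetricSpace M] {f : ℕ → M}
    (hf : ∀ n k, n ≠ k → dist (f n) (f k) = 1) (hg : ∀ g, ¬ ∀ n, dist g (f n) = 1) :
    IsMaximalEquilateral (Set.range f) := by
  refine ⟨⟨1, one_pos, ?_⟩, ?_⟩
  · rintro _ ⟨n, rfl⟩ _ ⟨k, rfl⟩ hnk
    exact hf n k fun h => hnk (h ▸ rfl)
  · rintro T ⟨l, -, hT⟩ hsub
    refine (Set.Subset.antisymm hsub fun g hgT => ?_).symm
    by_contra hgS
    have h01 : f 0 ≠ f 1 := fun h => by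
      have := hf 0 1 zero_ne_one
      rw [h, dist_self] at this
      exact zero_ne_one this
    have hl : l = 1 := by
      rw [← hT _ (hsub ⟨0, rfl⟩) _ (hsub ⟨1, rfl⟩) h01, hf 0 1 zero_ne_one]
    refine hg g fun n => ?_
    rw [hT g hgT (f n) (hsub ⟨n, rfl⟩) fun h => hgS ⟨n, h.symm⟩, hl]

/-- Corollary 5: for an infinite compact Hausdorff scattered space `K`, the minimum
cardinality of a maximal equilateral set in `C(K)` is `ℵ₀`. -/
theorem stmt19 {K : Type*} [TopologicalSpace K] [CompactSpace K] [T2Space K] [Infinite K]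
    (hK : IsScattered K) :
    mNum C(K, ℝ) = Cardinal.aleph0 := by
  obtain ⟨x, p, hx, hiso, hlim⟩ := hK.exists_seq_isolated
  obtain ⟨f, hf, hg⟩ := exists_unextendable_equilateral_seq hx hiso hlim
  have hinj : Function.Injective f := fun n k h => by
    by_contra hnk
    have := hf n k hnk
    rw [h, dist_self] at this
    exact zero_ne_one this
  have hmem : Cardinal.aleph0 ∈
      {c : Cardinal | ∃ S : Set C(K, ℝ), IsMaximalEquilateral S ∧ Cardinal.mk S = c} :=
    ⟨Set.range f, isMaximalEquilateral_range hf hg, by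
      have := Cardinal.mk_range_eq_of_injective hinj
      simpa using this⟩
  refine le_antisymm (csInf_le' hmem) (le_csInf ⟨_, hmem⟩ ?_)
  rintro _ ⟨S, hS, rfl⟩
  exact Cardinal.aleph0_le_mk_iff.2 hS.infinite.to_subtype
end
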